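/- Let (X, 𝒜, μ) be a probability space, (Y, ℬ) a measurable space, and κ a Markov kernel from X to Y; let ν := μ ⊗ κ. Let g : X × Y → ℝ^d be jointly measurable with ∫ ‖g‖² dν < ∞, let w : X → {0,1} be measurable with β := ∫ w dμ ∈ (0, 1], and define ĝ(x, y) := (w(x)/β) g(x, y), ḡ(x) := ∫ g(x, y) κ(x)(dy), and m := ∫ ĝ dν. Let σ² := (1/β) ∫ w(x) (∫ ‖g(x,y) − ḡ(x)‖² κ(x)(dy)) dμ(x) be the within-prompt variance over the selected set and V_prob the vector variance of ḡ under the conditional measure μ(· | w = 1). Suppose there exist constants a₁, a₂ ≥ 0 and α > 0 with σ² ≤ a₁ β^{1+α} and V_prob ≤ a₂ β^{1+α}. Then Var(ĝ) := ∫ ‖ĝ − m‖² dν ≤ (a₁ + a₂) β^α + ((1 − β)/β) ‖m‖². -/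

import Mathlib

open MeasureTheory ProbabilityTheory

/-- Expansion of the second moment of a square-integrable vector about a point. -/
lemma integral_norm_sub_const_sq {Ω E : Type*} [MeasurableSpace Ω] {P : Measure Ω}
    [IsProbabilityMeasure P] [NormedAddCommGroup E] [InnerProductSpace ℝ E] [CompleteSpace E]
    {f : Ω → E} (hf : MemLp f 2 P) (c : E) :
    ∫ x, ‖f x - c‖ ^ 2 ∂P = ∫ x, ‖f x‖ ^ 2 ∂P - 2 * inner ℝ c (∫ x, f x ∂P) + ‖c‖ ^ 2 := by
  have hi : Integrable f P := hf.integrable one_le_two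
  have hsq : Integrable (fun x => ‖f x‖ ^ 2) P := hf.integrable_norm_pow two_ne_zero
  have hin : Integrable (fun x => 2 * inner ℝ c (f x)) P := (hi.const_inner c).const_mul 2
  simp_rw [norm_sub_sq_real, real_inner_comm c]
  rw [integral_add (by exact hsq.sub hin) (integrable_const _), integral_sub hsq hin,
    integral_const_mul, integral_inner hi]
  simp

/-- The second moment about the mean of a square-integrable vector. -/
lemma integral_norm_sub_integral_sq {Ω E : Type*} [MeasurableSpace Ω] {P : Measure Ω}
    [IsProbabilityMeasure P] [NormedAddCommGroup E] [InnerProductSpace ℝ E] [CompleteSpace E]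
    {f : Ω → E} (hf : MemLp f 2 P) :
    ∫ x, ‖f x - ∫ x', f x' ∂P‖ ^ 2 ∂P = ∫ x, ‖f x‖ ^ 2 ∂P - ‖∫ x, f x ∂P‖ ^ 2 := by
  rw [integral_norm_sub_const_sq hf, real_inner_self_eq_norm_sq]
  ring

/-- The integral under a conditioned measure, written with the indicator weight. -/
lemma integral_cond_eq_smul_integral {X E : Type*} [MeasurableSpace X] [NormedAddCommGroup E]
    [NormedSpace ℝ E] (μ : Measure X) {w : X → ℝ} (hw : Measurable w)
    (hw01 : ∀ x, w x = 0 ∨ w x = 1) (f : X → E) :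
    ∫ x, f x ∂(μ[|{x | w x = 1}]) = (∫ x, w x ∂μ)⁻¹ • ∫ x, w x • f x ∂μ := by
  have hS : MeasurableSet {x | w x = 1} := hw (measurableSet_singleton 1)
  have hwS : w = Set.indicator {x | w x = 1} 1 := by
    ext x
    rcases hw01 x with h | h <;> simp [Set.indicator, h]
  have hμS : ∫ x, w x ∂μ = μ.real {x | w x = 1} := by
    conv_lhs => rw [hwS]
    exact integral_indicator_one hS
  have hwf : (fun x => w x • f x) = Set.indicator {x | w x = 1} f := by
    ext1 x
    rcases hw01 x with h | h <;> simp [Set.indicator, h]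
  rw [hμS, hwf, integral_indicator hS, ProbabilityTheory.cond, integral_smul_measure,
    ENNReal.toReal_inv, Measure.real]

/-- **Theorem 4 (Curriculum-Sensitive Variance Bound).**
If the action variance satisfies `σ² ≤ a₁ β^(1+α)` and the problem variance
satisfies `V_prob ≤ a₂ β^(1+α)` for constants `a₁, a₂ ≥ 0` and `α > 0`, then the
variance of the curriculum estimator is bounded as
`Var(ghat) ≤ (a₁ + a₂) β^α + ((1 − β)/β) ‖m‖²`. -/
theorem curriculum_sensitive_variance_bound
    {X Y : Type*} [MeasurableSpace X] [MeasurableSpace Y]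
    (μ : Measure X) [IsProbabilityMeasure μ]
    (κ : Kernel X Y) [IsMarkovKernel κ]
    {d : ℕ} (g : X × Y → EuclideanSpace ℝ (Fin d)) (hg : Measurable g)
    (hg2 : Integrable (fun p => ‖g p‖ ^ 2) (μ ⊗ₘ κ))
    (w : X → ℝ) (hw : Measurable w) (hw01 : ∀ x, w x = 0 ∨ w x = 1)
    (β : ℝ) (hβ : β = ∫ x, w x ∂μ) (hβ0 : 0 < β) (hβ1 : β ≤ 1)
    (ghat : X × Y → EuclideanSpace ℝ (Fin d))
    (hghat : ghat = fun p => (w p.1 / β) • g p)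
    (gbar : X → EuclideanSpace ℝ (Fin d))
    (hgbar : gbar = fun x => ∫ y, g (x, y) ∂(κ x))
    (m : EuclideanSpace ℝ (Fin d)) (hm : m = ∫ p, ghat p ∂(μ ⊗ₘ κ))
    (σ2 : ℝ)
    (hσ2 : σ2 = (1 / β) * ∫ x, w x * ∫ y, ‖g (x, y) - gbar x‖ ^ 2 ∂(κ x) ∂μ)
    (Vprob : ℝ)
    (hVprob : Vprob
      = ∫ x, ‖gbar x - ∫ x', gbar x' ∂(μ[|{x' | w x' = 1}])‖ ^ 2
          ∂(μ[|{x' | w x' = 1}]))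
    (a₁ a₂ α : ℝ) (ha₁ : 0 ≤ a₁) (ha₂ : 0 ≤ a₂) (hα : 0 < α)
    (hσ2le : σ2 ≤ a₁ * β ^ (1 + α)) (hVproble : Vprob ≤ a₂ * β ^ (1 + α)) :
    (∫ p, ‖ghat p - m‖ ^ 2 ∂(μ ⊗ₘ κ))
      ≤ (a₁ + a₂) * β ^ α + ((1 - β) / β) * ‖m‖ ^ 2 := by
  have hwn : ∀ x, ‖w x‖ ≤ 1 := fun x => by rcases hw01 x with h | h <;> simp [h]
  have hwsq : ∀ x, w x ^ 2 = w x := fun x => by rcases hw01 x with h | h <;> simp [h]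
  have hgL : MemLp g 2 (μ ⊗ₘ κ) :=
    (memLp_two_iff_integrable_sq_norm hg.aestronglyMeasurable).2 hg2
  have hfib : ∀ᵐ x ∂μ, MemLp (fun y => g (x, y)) 2 (κ x) := by
    filter_upwards [hg2.ae_of_compProd] with x hx
    exact (memLp_two_iff_integrable_sq_norm
      (hg.comp measurable_prodMk_left).aestronglyMeasurable).2 hx
  have hgbarm : StronglyMeasurable gbar := by
    rw [hgbar]
    exact hg.stronglyMeasurable.integral_kernel_prod_right'
  have hfibvar : ∀ᵐ x ∂μ, ∫ y, ‖g (x, y) - gbar x‖ ^ 2 ∂(κ x)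
      = ∫ y, ‖g (x, y)‖ ^ 2 ∂(κ x) - ‖gbar x‖ ^ 2 := by
    filter_upwards [hfib] with x hx
    rw [hgbar]
    exact integral_norm_sub_integral_sq hx
  have hsecond : Integrable (fun x => ∫ y, ‖g (x, y)‖ ^ 2 ∂(κ x)) μ := (Measure.integrable_compProd_iff hg2.1).1 hg2 |>.2.congr (by simp)
  have hgbarsq : Integrable (fun x => ‖gbar x‖ ^ 2) μ := by
    refine hsecond.mono' (hgbarm.norm.pow 2).aestronglyMeasurable ?_
    filter_upwards [hfibvar] with x hx
    have : 0 ≤ ∫ y, ‖g (x, y) - gbar x‖ ^ 2 ∂(κ x) := integral_nonneg fun y => by positivity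
    rw [Real.norm_of_nonneg (by positivity)]
    linarith
  have hgbarL : MemLp gbar 2 μ :=
    (memLp_two_iff_integrable_sq_norm hgbarm.aestronglyMeasurable).2 hgbarsq
  have hghatL : MemLp ghat 2 (μ ⊗ₘ κ) := by
    refine hgL.of_le_mul (c := 1 / β) ?_ (Filter.Eventually.of_forall fun p => ?_)
    · rw [hghat]
      exact (((hw.comp measurable_fst).div_const β).smul hg).aestronglyMeasurable
    · rw [hghat, norm_smul, norm_div, Real.norm_of_nonneg hβ0.le]
      gcongr
      exact hwn p.1
  have hm' : m = β⁻¹ • ∫ x, w x • gbar x ∂μ := by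
    rw [hm, Measure.integral_compProd (hghatL.integrable one_le_two), ← integral_smul, hghat,
      hgbar]
    simp only [integral_smul, smul_smul, div_eq_inv_mul]
  have hghatsq : ∫ p, ‖ghat p‖ ^ 2 ∂(μ ⊗ₘ κ)
      = (β⁻¹) ^ 2 * ∫ x, w x * ∫ y, ‖g (x, y)‖ ^ 2 ∂(κ x) ∂μ := by
    rw [Measure.integral_compProd (hghatL.integrable_norm_pow two_ne_zero),
      ← integral_const_mul, hghat]
    congr 1 with x
    simp only [norm_smul, mul_pow, integral_const_mul, Real.norm_eq_abs, sq_abs, div_pow, hwsq]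
    ring
  have hσ : σ2 = β⁻¹ * (∫ x, w x * ∫ y, ‖g (x, y)‖ ^ 2 ∂(κ x) ∂μ
      - ∫ x, w x * ‖gbar x‖ ^ 2 ∂μ) := by
    have hwi : ∀ {f : X → ℝ}, Integrable f μ → Integrable (fun x => w x * f x) μ := fun hf =>
      hf.bdd_mul hw.aestronglyMeasurable (Filter.Eventually.of_forall hwn)
    rw [hσ2, one_div, ← integral_sub (hwi hsecond) (hwi hgbarsq)]
    congr 1
    refine integral_congr_ae ?_
    filter_upwards [hfibvar] with x hx
    rw [hx, mul_sub]
  have hS0 : μ {x | w x = 1} ≠ 0 := by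
    intro h0
    have : ∀ᵐ x ∂μ, w x = 0 := by
      filter_upwards [measure_eq_zero_iff_ae_notMem.1 h0] with x hx
      exact (hw01 x).resolve_right hx
    rw [integral_congr_ae this, integral_zero] at hβ
    exact hβ0.ne' hβ
  have := cond_isProbabilityMeasure hS0
  have hcondL : MemLp gbar 2 (μ[|{x | w x = 1}]) := by
    rw [ProbabilityTheory.cond]
    exact (hgbarL.restrict _).smul_measure (ENNReal.inv_ne_top.2 hS0)
  have hV : Vprob = β⁻¹ * ∫ x, w x * ‖gbar x‖ ^ 2 ∂μ - ‖m‖ ^ 2 := by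
    rw [hVprob, integral_norm_sub_integral_sq hcondL,
      integral_cond_eq_smul_integral μ hw hw01, integral_cond_eq_smul_integral μ hw hw01,
      ← hβ, ← hm']
    rfl
  have hvar : ∫ p, ‖ghat p - m‖ ^ 2 ∂(μ ⊗ₘ κ)
      = (σ2 + Vprob) / β + ((1 - β) / β) * ‖m‖ ^ 2 := by
    have h := integral_norm_sub_integral_sq hghatL
    rw [← hm] at h
    rw [h, hghatsq, hσ, hV]
    field_simp
    ring
  rw [hvar]
  gcongr
  rw [div_le_iff₀ hβ0]
  rw [Real.rpow_add hβ0, Real.rpow_one] at hσ2le hVproble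
  linarith
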